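/- arXiv:1306.4283 — 2 statements merged into one kernel-verified Lean document; each statement's English description precedes it below -/
import Mathlib

section
/- If f is a primitive type, then there exists a positive integer n such that every rational in the support of f has denominator n when written in lowest terms. -/
/-- A *type* is a finitely supported function `f : ℚ →₀ ℕ` whose support lies in `[0,1)`
and such that `f x + f (fract (-x))` depends only on the denominator of `x` (in lowest
terms), for `x ∈ [0,1)`. -/
def IsAgeType (f : ℚ →₀ ℕ) : Prop :=
  (∀ x ∈ f.support, 0 ≤ x ∧ x < 1) ∧
  ∀ x y : ℚ, 0 ≤ x → x < 1 → 0 ≤ y → y < 1 → x.den = y.den →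
    f x + f (Int.fract (-x)) = f y + f (Int.fract (-y))

/-- A type is *primitive* if it is nonzero and is not the pointwise sum of two
nonzero types. -/
def IsPrimitiveType (f : ℚ →₀ ℕ) : Prop :=
  IsAgeType f ∧ f ≠ 0 ∧
    ¬ ∃ g h : ℚ →₀ ℕ, IsAgeType g ∧ IsAgeType h ∧ g ≠ 0 ∧ h ≠ 0 ∧ f = g + h

/-- The *weight* of a type: `∑ x·f(x)` over the support of `f`. -/
def typeWeight (f : ℚ →₀ ℕ) : ℚ :=
  ∑ x ∈ f.support, x * f x

theorem Rat.den_fract_neg (x : ℚ) : (Int.fract (-x)).den = x.den := by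
  rw [Rat.den_intFract, Rat.neg_den]

theorem IsAgeType.filter_den {f : ℚ →₀ ℕ} (hf : IsAgeType f) (p : ℕ → Prop) [DecidablePred p] :
    IsAgeType (f.filter fun x => p x.den) := by
  refine ⟨fun x hx => hf.1 x ?_, fun x y hx0 hx1 hy0 hy1 h => ?_⟩
  · rw [Finsupp.support_filter] at hx
    exact Finset.mem_of_mem_filter x hx
  · simp only [Finsupp.filter_apply, Rat.den_fract_neg, h]
    split_ifs
    · exact hf.2 x y hx0 hx1 hy0 hy1 h
    · rfl

theorem primitiveType_exists_denominator (f : ℚ →₀ ℕ) (hf : IsPrimitiveType f) :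
    ∃ n : ℕ, 0 < n ∧ ∀ x ∈ f.support, x.den = n := by
  obtain ⟨hage, hne, hprim⟩ := hf
  obtain ⟨x, hx⟩ := Finsupp.support_nonempty_iff.mpr hne
  refine ⟨x.den, x.den_pos, fun y hy => ?_⟩
  by_contra hyx
  refine hprim ⟨f.filter fun z => z.den = x.den, f.filter fun z => ¬z.den = x.den,
    hage.filter_den (· = x.den), hage.filter_den (¬· = x.den), fun h => ?_, fun h => ?_,
    (Finsupp.filter_add_filter_not f _).symm⟩
  · exact Finsupp.mem_support_iff.mp hx
      ((Finsupp.filter_apply_pos (fun z : ℚ => z.den = x.den) f rfl).symm.trans (DFunLike.congr_fun h x))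
  · exact Finsupp.mem_support_iff.mp hy
      ((Finsupp.filter_apply_pos _ f hyx).symm.trans (DFunLike.congr_fun h y))
end

section
/- Let f be a primitive type of denominator n with n ≥ 3. Then for every integer a with 0 < a < n and gcd(a,n) = 1, exactly one of a/n and (n−a)/n lies in the support of f; that is, f(a/n) + f((n−a)/n) = 1. -/
theorem Int.fract_neg_eq_one_sub {x : ℚ} (h0 : 0 < x) (h1 : x < 1) :
    Int.fract (-x) = 1 - x := by
  rw [Int.fract_eq_iff]
  exact ⟨by linarith, by linarith, -1, by push_cast; ring⟩

theorem Rat.pos_and_ne_half_of_three_le_den {x : ℚ} (h0 : 0 ≤ x) (h : 3 ≤ x.den) :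
    0 < x ∧ x ≠ 1 / 2 := by
  refine ⟨h0.lt_of_ne ?_, ?_⟩
  · rintro rfl
    simp at h
  · rintro rfl
    norm_num at h

/-- The part of `f` that picks, with multiplicity one, one point of the support of `f` out of
each pair `{x, 1 - x}` meeting it, preferring the one below `1 / 2`. -/
noncomputable def pairSelection (f : ℚ →₀ ℕ) : ℚ →₀ ℕ :=
  (f.mapRange (fun k => min k 1) (by simp)).filter (fun x => x < 1 / 2 ∨ f (1 - x) = 0)

theorem pairSelection_le (f : ℚ →₀ ℕ) : pairSelection f ≤ f := by
  intro x
  rw [pairSelection, Finsupp.filter_apply]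
  split_ifs <;> simp

theorem pairSelection_add_one_sub {f : ℚ →₀ ℕ} {x : ℚ} (hx : x ≠ 1 / 2)
    (hf : f x + f (1 - x) ≠ 0) : pairSelection f x + pairSelection f (1 - x) = 1 := by
  simp only [pairSelection, Finsupp.filter_apply, Finsupp.mapRange_apply, sub_sub_cancel]
  rcases lt_or_gt_of_ne hx with h | h
  · have h' : ¬ (1 - x < 1 / 2) := by linarith
    simp only [h, h', true_or, false_or, if_true]
    split_ifs <;> omega
  · have h' : 1 - x < 1 / 2 := by linarith
    simp only [not_lt.mpr h.le, h', true_or, false_or, if_true]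
    split_ifs <;> omega

/-- A function below a type supported on rationals of denominator `n ≥ 3` is itself a type
as soon as its sums over the pairs `{x, 1 - x}` of denominator `n` are constant. -/
theorem IsAgeType.of_le {f g : ℚ →₀ ℕ} {n : ℕ} (hn : 3 ≤ n) (hf : IsAgeType f)
    (hden : ∀ x ∈ f.support, x.den = n) (hg : g ≤ f) (c : ℕ)
    (hc : ∀ x : ℚ, 0 < x → x < 1 → x.den = n → g x + g (1 - x) = c) : IsAgeType g := by
  have zero : ∀ x : ℚ, x.den ≠ n → g x = 0 := fun x hx => by
    have : f x = 0 := by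
      by_contra h
      exact hx (hden x (Finsupp.mem_support_iff.mpr h))
    have := hg x
    omega
  refine ⟨fun x hx => hf.1 x (Finsupp.support_mono hg hx), ?_⟩
  have sum : ∀ x : ℚ, 0 ≤ x → x < 1 →
      g x + g (Int.fract (-x)) = if x.den = n then c else 0 := by
    intro x h0 h1
    rcases h0.eq_or_lt with rfl | hpos
    · have hd : (0 : ℚ).den ≠ n := by
        rw [Rat.den_zero]
        omega
      simp [zero 0 hd, show 1 ≠ n by omega]
    · rw [Int.fract_neg_eq_one_sub hpos h1]
      split_ifs with hd
      · exact hc x hpos h1 hd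
      · rw [zero x hd, zero (1 - x) (by simpa using hd)]
  intro x y hx0 hx1 hy0 hy1 hxy
  rw [sum x hx0 hx1, sum y hy0 hy1, hxy]

/-- In a primitive type of denominator `n ≥ 3`, the pairs `{x, 1 - x}` have total
multiplicity one. -/
theorem IsPrimitiveType.add_one_sub_eq_one {f : ℚ →₀ ℕ} {n : ℕ} (hn : 3 ≤ n)
    (hf : IsPrimitiveType f) (hden : ∀ x ∈ f.support, x.den = n) {x : ℚ}
    (h0 : 0 < x) (h1 : x < 1) (hx : x.den = n) : f x + f (1 - x) = 1 := by
  obtain ⟨hT, hne, hprim⟩ := hf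
  have const : ∀ y : ℚ, 0 < y → y < 1 → y.den = n → f y + f (1 - y) = f x + f (1 - x) := by
    intro y hy0 hy1 hy
    have := hT.2 y x hy0.le hy1 h0.le h1 (hy.trans hx.symm)
    rwa [Int.fract_neg_eq_one_sub hy0 hy1, Int.fract_neg_eq_one_sub h0 h1] at this
  have pos : f x + f (1 - x) ≠ 0 := by
    obtain ⟨z, hz⟩ := Finsupp.support_nonempty_iff.mpr hne
    obtain ⟨hz0, hz1⟩ := hT.1 z hz
    have hzn := hden z hz
    have := const z (Rat.pos_and_ne_half_of_three_le_den hz0 (hzn ▸ hn)).1 hz1 hzn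
    have := Finsupp.mem_support_iff.mp hz
    omega
  have sel : ∀ y : ℚ, 0 < y → y < 1 → y.den = n →
      pairSelection f y + pairSelection f (1 - y) = 1 := fun y hy0 hy1 hy =>
    pairSelection_add_one_sub (Rat.pos_and_ne_half_of_three_le_den hy0.le (hy ▸ hn)).2
      (const y hy0 hy1 hy ▸ pos)
  have rest : ∀ y : ℚ, 0 < y → y < 1 → y.den = n →
      (f - pairSelection f) y + (f - pairSelection f) (1 - y) = f x + f (1 - x) - 1 := by
    intro y hy0 hy1 hy
    have := sel y hy0 hy1 hy
    have := const y hy0 hy1 hy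
    have := pairSelection_le f y
    have := pairSelection_le f (1 - y)
    simp only [Finsupp.tsub_apply]
    omega
  by_contra hone
  refine hprim ⟨pairSelection f, f - pairSelection f,
    hT.of_le hn hden (pairSelection_le f) _ sel, hT.of_le hn hden tsub_le_self _ rest, ?_, ?_,
    (add_tsub_cancel_of_le (pairSelection_le f)).symm⟩
  · intro h
    simpa [h] using sel x h0 h1 hx
  · intro h
    have := rest x h0 h1 hx
    simp only [h, Finsupp.coe_zero, Pi.zero_apply] at this
    omega

theorem primitiveType_exactly_one_of_pair (f : ℚ →₀ ℕ) (n : ℕ) (hn : 3 ≤ n)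
    (hf : IsPrimitiveType f) (hden : ∀ x ∈ f.support, x.den = n) :
    ∀ a : ℕ, 0 < a → a < n → Nat.Coprime a n →
      f ((a : ℚ) / n) + f (((n - a : ℕ) : ℚ) / n) = 1 := by
  intro a ha han hco
  have hn0 : (0 : ℚ) < n := by exact_mod_cast (by omega : 0 < n)
  have hsub : ((n - a : ℕ) : ℚ) / n = 1 - (a : ℚ) / n := by
    rw [Nat.cast_sub han.le, sub_div, div_self hn0.ne']
  have hd : ((a : ℚ) / n).den = n := by
    have h := Rat.den_div_eq_of_coprime (a := a) (b := n) (by omega) (by simpa using hco)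
    simpa only [Int.cast_natCast, Nat.cast_inj] using h
  rw [hsub]
  exact hf.add_one_sub_eq_one hn hden (div_pos (by exact_mod_cast ha) hn0)
    ((div_lt_one hn0).mpr (by exact_mod_cast han)) hd
end
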